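/- arXiv:2412.01139 — 2 statements merged into one kernel-verified Lean document; each statement's English description precedes it below -/
import Mathlib

section
/- Suppose the noise density f is piecewise monotone, its largest global maximizer x_m exists and is a mode of f, B_1(t) ≤ B_1(x_m) for all t ∈ ℝ, and the hazard rate x ↦ f(x)/(1−F(x)) is nondecreasing on {x > x_m : F(x) < 1}. Then for every t ∈ ℝ and every prize schedule v ∈ 𝒱, g(t; v) ≤ g(x_m; v^WTA) = B_1(x_m). (The winner-take-all schedule together with the threshold at the global mode maximizes the marginal benefit of effort over all thresholds and all prize schedules.) -/
open MeasureTheory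

/-- The CDF associated with a density `f`. -/
noncomputable def Fcdf (f : ℝ → ℝ) (x : ℝ) : ℝ := ∫ u in Set.Iic x, f u

/-- `F_{(j:m)}`, the CDF of the `j`-th smallest of `m` i.i.d. draws (binomial-sum form),
with the convention `F_{(0:m)} ≡ 1`. -/
noncomputable def Fos (f : ℝ → ℝ) (j m : ℕ) (x : ℝ) : ℝ :=
  if j = 0 then 1
  else ∑ k ∈ Finset.Icc j m, (m.choose k : ℝ) * Fcdf f x ^ k * (1 - Fcdf f x) ^ (m - k)

/-- `f_{(j:m)}`, the density of the `j`-th smallest of `m` i.i.d. draws,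
with the convention `f_{(0:m)} ≡ 0`. -/
noncomputable def fos (f : ℝ → ℝ) (j m : ℕ) (x : ℝ) : ℝ :=
  if j = 0 then 0
  else (j : ℝ) * (m.choose j : ℝ) * Fcdf f x ^ (j - 1) * (1 - Fcdf f x) ^ (m - j) * f x

/-- The marginal-benefit coefficient `B_r(t)`. -/
noncomputable def Bcoef (f : ℝ → ℝ) (n r : ℕ) (t : ℝ) : ℝ :=
  f t * Fos f (n - r) (n - 1) t + ∫ x in Set.Ioi t, f x * fos f (n - r) (n - 1) x

/-- The marginal benefit of effort `g(t; v)` with threshold `t` and prize schedule `v`. -/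
noncomputable def gmb (f : ℝ → ℝ) (n : ℕ) (v : ℕ → ℝ) (t : ℝ) : ℝ :=
  ∑ r ∈ Finset.Icc 1 n, Bcoef f n r t * (v r - v (r + 1))

/-- A noise density: nonnegative, bounded, integrating to one, vanishing outside
`[xl, xu]` and continuous there.  The endpoints may be infinite. -/
def IsNoiseDensity (f : ℝ → ℝ) (xl xu : EReal) : Prop :=
  xl < xu ∧ (∀ x, 0 ≤ f x) ∧ (∃ M, ∀ x, f x ≤ M) ∧ (∫ x, f x = 1) ∧
    (∀ x : ℝ, ((x : EReal) < xl ∨ xu < (x : EReal)) → f x = 0) ∧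
    ContinuousOn f {x : ℝ | xl ≤ (x : EReal) ∧ (x : EReal) ≤ xu}

/-- A prize schedule `v = (v 1, …, v n)`: nonincreasing, nonnegative, summing to one,
with the convention `v (n+1) = 0`. -/
def IsPrizeSchedule (n : ℕ) (v : ℕ → ℝ) : Prop :=
  (∀ r ∈ Finset.Icc 1 n, 0 ≤ v r) ∧ (∀ r, 1 ≤ r → r < n → v (r + 1) ≤ v r) ∧
    (∑ r ∈ Finset.Icc 1 n, v r = 1) ∧ v (n + 1) = 0

/-- `m` is a mode of `f`. -/
def IsMode (f : ℝ → ℝ) (m : ℝ) : Prop :=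
  ∃ a b : ℝ, a < m ∧ m < b ∧ MonotoneOn f (Set.Icc a m) ∧ AntitoneOn f (Set.Icc m b) ∧
    f a < f m ∧ f b < f m

/-- `f` is piecewise monotone: away from finitely many points it is monotone. -/
def PiecewiseMonotone (f : ℝ → ℝ) : Prop :=
  ∃ s : Finset ℝ, ∀ a b : ℝ, a < b → (∀ c ∈ s, c ∉ Set.Ioo a b) →
    MonotoneOn f (Set.Ioo a b) ∨ AntitoneOn f (Set.Ioo a b)

section

open Set Filter Topology Polynomial

/-- The upper binomial tail `∑_{k ≥ j} C(m,k) X^k (1-X)^(m-k)` as a polynomial. -/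
noncomputable def binomialTail (m j : ℕ) : ℝ[X] :=
  ∑ k ∈ Finset.Icc j m, bernsteinPolynomial ℝ m k

lemma eval_bernsteinPolynomial (m k : ℕ) (u : ℝ) :
    (bernsteinPolynomial ℝ m k).eval u = (m.choose k : ℝ) * u ^ k * (1 - u) ^ (m - k) := by
  simp [bernsteinPolynomial]

lemma eval_bernsteinPolynomial_nonneg (m k : ℕ) {u : ℝ} (h0 : 0 ≤ u) (h1 : u ≤ 1) :
    0 ≤ (bernsteinPolynomial ℝ m k).eval u := by
  rw [eval_bernsteinPolynomial]
  have : 0 ≤ 1 - u := by linarith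
  positivity

lemma binomialTail_zero (m : ℕ) : binomialTail m 0 = 1 := by
  rw [binomialTail, ← bernsteinPolynomial.sum ℝ m]
  congr 1
  ext k
  simp

lemma binomialTail_eq_add {m j : ℕ} (hj : j ≤ m) :
    binomialTail m j = bernsteinPolynomial ℝ m j + binomialTail m (j + 1) := by
  rw [binomialTail, binomialTail, ← Finset.insert_Icc_add_one_left_eq_Icc hj,
    Finset.sum_insert (by simp)]

lemma binomialTail_self (m : ℕ) : binomialTail m m = X ^ m := by
  simp [binomialTail, bernsteinPolynomial]

lemma binomialTail_eval_one {m j : ℕ} (hj : j ≤ m) : (binomialTail m j).eval 1 = 1 := by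
  simp [binomialTail, eval_finsetSum, bernsteinPolynomial.eval_at_1, hj]

lemma derivative_binomialTail_succ {m j : ℕ} (hj : j ≤ m) :
    derivative (binomialTail (m + 1) (j + 1)) = (m + 1) * bernsteinPolynomial ℝ m j := by
  induction hj using Nat.decreasingInduction with
  | self =>
    simp [binomialTail_self, bernsteinPolynomial]
  | of_succ k hk ih =>
    rw [binomialTail_eq_add (by omega), derivative_add, ih,
      bernsteinPolynomial.derivative_succ_aux]
    ring

lemma one_sub_X_mul_derivative_binomialTail {m j : ℕ} (hj : j ≤ m) :
    ((m : ℝ[X]) + 1) * ((1 - X) * derivative (binomialTail m j)) =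
      ((m + 1 - j : ℕ) : ℝ[X]) * derivative (binomialTail (m + 1) j) := by
  rcases j with _ | j
  · simp [binomialTail_zero]
  obtain ⟨m, rfl⟩ : ∃ k, m = k + 1 := ⟨m - 1, by omega⟩
  rw [derivative_binomialTail_succ (by omega), derivative_binomialTail_succ (by omega)]
  have h : ((m.choose j : ℕ) : ℝ[X]) * (m + 1) =
      (((m + 1).choose j : ℕ) : ℝ[X]) * ((m + 1 - j : ℕ) : ℝ[X]) := by
    exact_mod_cast congrArg (Nat.cast : ℕ → ℝ[X]) (Nat.choose_mul_succ_eq m j)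
  rw [bernsteinPolynomial, bernsteinPolynomial, show m + 1 - j = m - j + 1 by omega, pow_succ,
    show m + 1 + 1 - (j + 1) = m - j + 1 by omega]
  rw [show m + 1 - j = m - j + 1 by omega] at h
  push_cast at h ⊢
  linear_combination (↑m + 1 + 1) * (1 - X) ^ (m - j) * (1 - X) * X ^ j * h

lemma one_sub_mul_eval_bernsteinPolynomial {m k : ℕ} (hk : k ≤ m) (u : ℝ) :
    ((m : ℝ) + 1) * ((1 - u) * (bernsteinPolynomial ℝ m k).eval u) =
      ((m : ℝ) + 1 - k) * (bernsteinPolynomial ℝ (m + 1) k).eval u := by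
  have h : ((m.choose k : ℕ) : ℝ) * (m + 1) =
      (((m + 1).choose k : ℕ) : ℝ) * ((m + 1 - k : ℕ) : ℝ) := by
    exact_mod_cast congrArg (Nat.cast : ℕ → ℝ) (Nat.choose_mul_succ_eq m k)
  rw [Nat.cast_sub (by omega)] at h
  rw [eval_bernsteinPolynomial, eval_bernsteinPolynomial, show m + 1 - k = m - k + 1 by omega,
    pow_succ]
  push_cast at h
  linear_combination u ^ k * (1 - u) ^ (m - k) * (1 - u) * h

lemma binomialTail_eval_anti {m j : ℕ} (hj : j ≤ m) {u : ℝ} (h0 : 0 ≤ u) (h1 : u ≤ 1) (N : ℕ) :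
    (binomialTail N m).eval u ≤ (binomialTail N j).eval u := by
  rw [binomialTail, binomialTail, eval_finsetSum, eval_finsetSum]
  exact Finset.sum_le_sum_of_subset_of_nonneg (Finset.Icc_subset_Icc_left hj)
    fun k _ _ => eval_bernsteinPolynomial_nonneg N k h0 h1

/-- Comparison of the total masses of the two hazard-rate weightings. -/
lemma binomialTail_mass_le {m j : ℕ} (hj : j ≤ m) {u : ℝ} (h0 : 0 ≤ u) (h1 : u ≤ 1) :
    ((m : ℝ) + 1 - j) * ((binomialTail (m + 1) m).eval u - (binomialTail (m + 1) j).eval u) ≤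
      ((m : ℝ) + 1) * (1 - u) *
        (((m : ℝ) + 1 - j) * (binomialTail m m).eval u - (binomialTail m j).eval u) := by
  have hsplit : ∀ i ≤ m, (binomialTail (m + 1) i).eval u =
      (∑ k ∈ Finset.Icc i m, (bernsteinPolynomial ℝ (m + 1) k).eval u) + u ^ (m + 1) := by
    intro i hi
    rw [binomialTail, eval_finsetSum, ← Finset.insert_Icc_right_eq_Icc_add_one (by omega),
      Finset.sum_insert (by simp)]
    simp [bernsteinPolynomial, add_comm]
  have hscale : ((m : ℝ) + 1) * (1 - u) * (binomialTail m j).eval u ≤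
      ((m : ℝ) + 1 - j) * ∑ k ∈ Finset.Icc j m, (bernsteinPolynomial ℝ (m + 1) k).eval u := by
    rw [binomialTail, eval_finsetSum, Finset.mul_sum, Finset.mul_sum]
    refine Finset.sum_le_sum fun k hk => ?_
    rw [Finset.mem_Icc] at hk
    rw [mul_assoc, one_sub_mul_eval_bernsteinPolynomial hk.2]
    have : (j : ℝ) ≤ k := by exact_mod_cast hk.1
    have := eval_bernsteinPolynomial_nonneg (m + 1) k h0 h1
    gcongr
  have hself : ((m : ℝ) + 1) * ((1 - u) * (binomialTail m m).eval u) =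
      (bernsteinPolynomial ℝ (m + 1) m).eval u := by
    have := one_sub_mul_eval_bernsteinPolynomial (le_refl m) u
    simpa [binomialTail] using this
  rw [hsplit m le_rfl, hsplit j hj]
  simp only [Finset.Icc_self, Finset.sum_singleton]
  linear_combination hscale - ((m : ℝ) + 1 - j) * hself

/-- The derivative of `r • binomialTail m m - binomialTail m j`, with `r = m + 1 - j`, changes sign
at most once, from negative to positive. -/
lemma exists_single_crossing {m j : ℕ} (hj : j < m) :
    ∃ (e : ℕ) (k : ℝ → ℝ), Continuous k ∧ MonotoneOn k (Icc 0 1) ∧ 0 < k 1 ∧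
      ∀ u, ((m : ℝ) + 1 - j) * (derivative (binomialTail m m)).eval u -
        (derivative (binomialTail m j)).eval u = u ^ e * k u := by
  obtain ⟨m, rfl⟩ : ∃ k, m = k + 1 := ⟨m - 1, by omega⟩
  have hr : 0 < ((m + 1 : ℕ) : ℝ) + 1 - j := by
    have : (j : ℝ) < ((m + 1 : ℕ) : ℝ) := by exact_mod_cast hj
    linarith
  rcases j with _ | j
  · refine ⟨0, fun u => (((m + 1 : ℕ) : ℝ) + 1 - (0 : ℕ)) * ((m + 1) * u ^ m), by fun_prop,
      ?_, by positivity, ?_⟩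
    · intro u hu v hv huv
      have := hu.1
      dsimp only
      gcongr
    · intro u
      simp [binomialTail_self, binomialTail_zero]
  · set r : ℝ := ((m + 1 : ℕ) : ℝ) + 1 - (j + 1 : ℕ)
    refine ⟨j, fun u => (m + 1) * (r * u ^ (m - j) - (m.choose j) * (1 - u) ^ (m - j)),
      by fun_prop, ?_, ?_, ?_⟩
    · intro u hu v hv huv
      have := hu.1
      have : 0 ≤ 1 - v := by linarith [hv.2]
      dsimp only
      gcongr
    · have : m - j ≠ 0 := by omega
      simp only [one_pow, sub_self, zero_pow this]
      simp only [mul_one, mul_zero, sub_zero]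
      positivity
    · intro u
      rw [binomialTail_self, derivative_binomialTail_succ (by omega)]
      have : u ^ m = u ^ j * u ^ (m - j) := by rw [← pow_add]; congr 1; omega
      simp [bernsteinPolynomial, this]
      ring

section Density

variable {f : ℝ → ℝ} {xl xu : EReal}

lemma IsNoiseDensity.integrable (hf : IsNoiseDensity f xl xu) : Integrable f := by
  by_contra h
  have := hf.2.2.2.1
  rw [integral_undef h] at this
  exact zero_ne_one this

lemma Fcdf_eq_add (hi : Integrable f) (a x : ℝ) :
    Fcdf f x = Fcdf f a + ∫ u in a..x, f u := by
  rw [Fcdf, Fcdf, ← intervalIntegral.integral_Iic_sub_Iic hi.integrableOn hi.integrableOn]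
  ring

lemma continuous_Fcdf (hi : Integrable f) : Continuous (Fcdf f) := by
  rw [funext (Fcdf_eq_add hi 0)]
  exact continuous_const.add (hi.continuous_primitive 0)

lemma hasDerivAt_Fcdf (hi : Integrable f) {x : ℝ} (hx : ContinuousAt f x) :
    HasDerivAt (Fcdf f) (f x) x := by
  rw [funext (Fcdf_eq_add hi 0)]
  exact (intervalIntegral.integral_hasDerivAt_right hi.intervalIntegrable
    hi.aestronglyMeasurable.stronglyMeasurableAtFilter hx).const_add _

lemma tendsto_Fcdf (hf : IsNoiseDensity f xl xu) : Tendsto (Fcdf f) atTop (𝓝 1) := by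
  rw [← hf.2.2.2.1]
  exact (aecover_Iic tendsto_id).integral_tendsto_of_countably_generated hf.integrable

lemma monotone_Fcdf (hf : IsNoiseDensity f xl xu) : Monotone (Fcdf f) := fun x y hxy => by
  rw [Fcdf_eq_add hf.integrable x y]
  linarith [intervalIntegral.integral_nonneg_of_forall (μ := volume) hxy hf.2.1]

lemma Fcdf_nonneg (hf : IsNoiseDensity f xl xu) (x : ℝ) : 0 ≤ Fcdf f x :=
  integral_nonneg hf.2.1

lemma Fcdf_le_one (hf : IsNoiseDensity f xl xu) (x : ℝ) : Fcdf f x ≤ 1 :=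
  (monotone_Fcdf hf).ge_of_tendsto (tendsto_Fcdf hf) x

lemma IsNoiseDensity.continuousAt (hf : IsNoiseDensity f xl xu) {x : ℝ}
    (hl : (x : EReal) ≠ xl) (hu : (x : EReal) ≠ xu) : ContinuousAt f x := by
  have hcoe : Continuous (fun y : ℝ => (y : EReal)) := continuous_coe_real_ereal
  rcases lt_or_gt_of_ne hl with h | h
  · have : f =ᶠ[𝓝 x] fun _ => 0 := by
      filter_upwards [(isOpen_Iio.preimage hcoe).mem_nhds h] with y hy
      exact hf.2.2.2.2.1 y (Or.inl hy)
    exact continuousAt_const.congr this.symm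
  rcases lt_or_gt_of_ne hu with h' | h'
  · refine hf.2.2.2.2.2.continuousAt ?_
    filter_upwards [(isOpen_Ioi.preimage hcoe).mem_nhds h,
      (isOpen_Iio.preimage hcoe).mem_nhds h'] with y hy hy'
    exact ⟨le_of_lt hy, le_of_lt hy'⟩
  · have : f =ᶠ[𝓝 x] fun _ => 0 := by
      filter_upwards [(isOpen_Ioi.preimage hcoe).mem_nhds h'] with y hy
      exact hf.2.2.2.2.1 y (Or.inr hy)
    exact continuousAt_const.congr this.symm

lemma integrable_eval_Fcdf_mul (hf : IsNoiseDensity f xl xu) (P : ℝ[X]) {g : ℝ → ℝ}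
    (hg : Integrable g) : Integrable fun x => P.eval (Fcdf f x) * g x := by
  obtain ⟨C, hC⟩ := isCompact_Icc.exists_bound_of_continuousOn (s := Icc (0 : ℝ) 1)
    P.continuous.continuousOn
  exact hg.bdd_mul (P.continuous.comp (continuous_Fcdf hf.integrable)).aestronglyMeasurable
    (ae_of_all _ fun x => hC _ ⟨Fcdf_nonneg hf x, Fcdf_le_one hf x⟩)

lemma integral_derivative_eval_Fcdf (hf : IsNoiseDensity f xl xu) (P : ℝ[X]) {a b : ℝ}
    (hab : a ≤ b) :
    ∫ x in a..b, (derivative P).eval (Fcdf f x) * f x =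
      P.eval (Fcdf f b) - P.eval (Fcdf f a) := by
  refine integral_eq_of_hasDerivAt_off_countable_of_le (fun x => P.eval (Fcdf f x)) _ hab
    (s := {xl.toReal, xu.toReal}) (by simp)
    (P.continuous.comp (continuous_Fcdf hf.integrable)).continuousOn ?_
    (integrable_eval_Fcdf_mul hf _ hf.integrable).intervalIntegrable
  rintro x ⟨-, hx⟩
  simp only [mem_insert_iff, mem_singleton_iff, not_or] at hx
  refine (P.hasDerivAt _).comp x (hasDerivAt_Fcdf hf.integrable (hf.continuousAt ?_ ?_))
  · rintro rfl
    simp at hx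
  · rintro rfl
    simp at hx

lemma integral_Ioi_derivative_eval_Fcdf (hf : IsNoiseDensity f xl xu) (P : ℝ[X]) (t : ℝ) :
    ∫ x in Ioi t, (derivative P).eval (Fcdf f x) * f x = P.eval 1 - P.eval (Fcdf f t) := by
  refine tendsto_nhds_unique (intervalIntegral_tendsto_integral_Ioi t
    (integrable_eval_Fcdf_mul hf _ hf.integrable).integrableOn tendsto_id) ?_
  refine Tendsto.congr' ?_
    (((P.continuous.tendsto 1).comp (tendsto_Fcdf hf)).sub_const (P.eval (Fcdf f t)))
  filter_upwards [eventually_ge_atTop t] with b hb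
  exact (integral_derivative_eval_Fcdf hf P hb).symm

lemma Fos_eq_eval (m j : ℕ) (x : ℝ) : Fos f j m x = (binomialTail m j).eval (Fcdf f x) := by
  rw [Fos]
  split_ifs with h
  · simp [h, binomialTail_zero]
  · simp [binomialTail, eval_finsetSum, eval_bernsteinPolynomial]

lemma fos_eq_eval {m j : ℕ} (hj : j ≤ m) (x : ℝ) :
    fos f j m x = (derivative (binomialTail m j)).eval (Fcdf f x) * f x := by
  rw [fos]
  split_ifs with h
  · simp [h, binomialTail_zero]
  · obtain ⟨j, rfl⟩ := Nat.exists_eq_succ_of_ne_zero h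
    obtain ⟨m, rfl⟩ : ∃ k, m = k + 1 := ⟨m - 1, by omega⟩
    have hc : ((m : ℝ) + 1) * m.choose j = (m + 1).choose (j + 1) * (j + 1) := by
      exact_mod_cast Nat.add_one_mul_choose_eq m j
    rw [Nat.succ_eq_add_one, derivative_binomialTail_succ (by omega), eval_mul,
      eval_bernsteinPolynomial]
    simp only [eval_add, eval_natCast, eval_one, Nat.add_sub_add_right, Nat.add_sub_cancel]
    push_cast
    linear_combination -Fcdf f x ^ j * (1 - Fcdf f x) ^ (m - j) * f x * hc

lemma Bcoef_eq (m r : ℕ) (hr : 1 ≤ r) (t : ℝ) :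
    Bcoef f (m + 1) r t = f t * (binomialTail m (m + 1 - r)).eval (Fcdf f t) +
      ∫ x in Ioi t, f x *
        ((derivative (binomialTail m (m + 1 - r))).eval (Fcdf f x) * f x) := by
  rw [Bcoef, Nat.add_sub_cancel, Fos_eq_eval]
  congr 1
  refine integral_congr_ae (ae_of_all _ fun x => ?_)
  dsimp only
  rw [fos_eq_eval (by omega)]

lemma integrable_mul_eval_Fcdf_mul (hf : IsNoiseDensity f xl xu) (P : ℝ[X]) :
    Integrable fun x => f x * (P.eval (Fcdf f x) * f x) := by
  obtain ⟨M, hM⟩ := hf.2.2.1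
  refine (integrable_eval_Fcdf_mul hf P hf.integrable).bdd_mul
    hf.integrable.aestronglyMeasurable (c := M) (ae_of_all _ fun x => ?_)
  rw [Real.norm_of_nonneg (hf.2.1 x)]
  exact hM x

lemma Bcoef_le_of_le (hf : IsNoiseDensity f xl xu) {xm : ℝ} (hmax : ∀ x, f x ≤ f xm)
    {m r : ℕ} (hr : 1 ≤ r) {t : ℝ} (ht : t ≤ xm) :
    Bcoef f (m + 1) r t ≤ Bcoef f (m + 1) r xm := by
  rw [Bcoef_eq m r hr, Bcoef_eq m r hr]
  set j := m + 1 - r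
  have hjm : j ≤ m := by omega
  set P := binomialTail m j
  have hint := integrable_mul_eval_Fcdf_mul hf (derivative P)
  have hder : ∀ x, 0 ≤ (derivative P).eval (Fcdf f x) := by
    intro x
    rcases Nat.eq_zero_or_pos j with h | h
    · simp [P, h, binomialTail_zero]
    · obtain ⟨i, hi⟩ : ∃ i, j = i + 1 := ⟨j - 1, by omega⟩
      obtain ⟨k, hk⟩ : ∃ k, m = k + 1 := ⟨m - 1, by omega⟩
      simp only [P, hi, hk]
      rw [derivative_binomialTail_succ (by omega), eval_mul]
      have := eval_bernsteinPolynomial_nonneg k i (Fcdf_nonneg hf x) (Fcdf_le_one hf x)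
      simp only [eval_add, eval_natCast, eval_one]
      positivity
  have hsplit := intervalIntegral.integral_Ioi_sub_Ioi hint.integrableOn ht
  have hle : ∫ x in t..xm, f x * ((derivative P).eval (Fcdf f x) * f x) ≤
      ∫ x in t..xm, f xm * ((derivative P).eval (Fcdf f x) * f x) := by
    refine intervalIntegral.integral_mono_on ht hint.intervalIntegrable
      ((integrable_eval_Fcdf_mul hf _ hf.integrable).const_mul _).intervalIntegrable
      fun x _ => ?_
    exact mul_le_mul_of_nonneg_right (hmax x) (mul_nonneg (hder x) (hf.2.1 x))
  rw [intervalIntegral.integral_const_mul, integral_derivative_eval_Fcdf hf P ht] at hle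
  have hP : 0 ≤ P.eval (Fcdf f t) := by
    simp only [P, binomialTail, eval_finsetSum]
    exact Finset.sum_nonneg fun k _ =>
      eval_bernsteinPolynomial_nonneg m k (Fcdf_nonneg hf t) (Fcdf_le_one hf t)
  have := mul_le_mul_of_nonneg_right (hmax t) hP
  linarith

/-- With a nondecreasing hazard rate on `[t, ∞)`, rank `r` is at most `r` times as useful as
rank `1`. -/
lemma Bcoef_le_mul_Bcoef_one (hf : IsNoiseDensity f xl xu) {m r : ℕ} (hm : 1 ≤ m)
    (hr : 1 ≤ r) (hrm : r ≤ m + 1) {t : ℝ}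
    (hifr : ∀ x y : ℝ, t ≤ x → x ≤ y → Fcdf f y < 1 →
      f x / (1 - Fcdf f x) ≤ f y / (1 - Fcdf f y)) :
    Bcoef f (m + 1) r t ≤ r * Bcoef f (m + 1) 1 t := by
  rcases hr.eq_or_lt with rfl | hr1
  · simp
  rw [Bcoef_eq m r hr, Bcoef_eq m 1 le_rfl, Nat.add_sub_cancel]
  obtain ⟨j, hj, hjr⟩ : ∃ j, j < m ∧ m + 1 - r = j := ⟨_, by omega, rfl⟩
  rw [hjr]
  have hrj : (r : ℝ) = (m : ℝ) + 1 - j := by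
    rw [← hjr, Nat.cast_sub hrm]; push_cast; ring
  have hr0 : (1 : ℝ) < r := by exact_mod_cast hr1
  obtain ⟨e, k, hkc, hkm, hk1, hk⟩ := exists_single_crossing hj
  rw [← hrj] at hk
  have hF0 := Fcdf_nonneg hf
  have hF1 := Fcdf_le_one hf
  have hFmem : ∀ x, Fcdf f x ∈ Icc (0 : ℝ) 1 := fun x => ⟨hF0 x, hF1 x⟩
  set W : ℝ[X] := C (r : ℝ) * binomialTail m m - binomialTail m j
  have hW : ∀ u, (derivative W).eval u = u ^ e * k u := fun u => by
    rw [← hk u]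
    simp [W]
  have hWsub : (r : ℝ) * ∫ x in Ioi t,
      f x * ((derivative (binomialTail m m)).eval (Fcdf f x) * f x) =
      (∫ x in Ioi t, f x * ((derivative W).eval (Fcdf f x) * f x)) +
      ∫ x in Ioi t, f x * ((derivative (binomialTail m j)).eval (Fcdf f x) * f x) := by
    rw [← integral_add (integrable_mul_eval_Fcdf_mul hf _).integrableOn
      (integrable_mul_eval_Fcdf_mul hf _).integrableOn, ← integral_const_mul]
    refine integral_congr_ae (ae_of_all _ fun x => ?_)
    simp [W]
    ring
  suffices hmain : 0 ≤ f t * W.eval (Fcdf f t) +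
      ∫ x in Ioi t, f x * ((derivative W).eval (Fcdf f x) * f x) by
    have : W.eval (Fcdf f t) = r * (binomialTail m m).eval (Fcdf f t) -
        (binomialTail m j).eval (Fcdf f t) := by simp [W]
    rw [this] at hmain
    linear_combination hmain - hWsub
  rcases (hF1 t).eq_or_lt with ht | ht
  · refine add_nonneg (mul_nonneg (hf.2.1 t) ?_) (setIntegral_nonneg measurableSet_Ioi ?_)
    · simp only [W, ht, eval_sub, eval_mul, eval_C, binomialTail_eval_one le_rfl,
        binomialTail_eval_one hj.le]
      linarith
    · intro x hx
      have hx1 : Fcdf f x = 1 :=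
        le_antisymm (hF1 x) (ht ▸ monotone_Fcdf hf (le_of_lt hx))
      rw [hW, hx1]
      have := hf.2.1 x
      positivity
  -- a hazard level separating the two signs of the weight
  obtain ⟨s, hts, hs1, hneg, hpos⟩ : ∃ s, t ≤ s ∧ Fcdf f s < 1 ∧
      (∀ x, t < x → x ≤ s → k (Fcdf f x) ≤ 0) ∧ (∀ x, s ≤ x → 0 ≤ k (Fcdf f x)) := by
    have hmono : ∀ x y, x ≤ y → k (Fcdf f x) ≤ k (Fcdf f y) := fun x y hxy =>
      hkm (hFmem x) (hFmem y) (monotone_Fcdf hf hxy)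
    rcases le_total 0 (k (Fcdf f t)) with h | h
    · exact ⟨t, le_rfl, ht, fun x hx hx' => absurd hx (not_lt.2 hx'),
        fun x hx => h.trans (hmono _ _ hx)⟩
    · obtain ⟨b, hb, hbt⟩ := ((((hkc.tendsto 1).comp (tendsto_Fcdf hf)).eventually
        (eventually_gt_nhds hk1)).and (eventually_ge_atTop t)).exists
      obtain ⟨s, hs, hs0⟩ := intermediate_value_Icc hbt
        (hkc.comp (continuous_Fcdf hf.integrable)).continuousOn
        (show (0 : ℝ) ∈ Icc ((k ∘ Fcdf f) t) ((k ∘ Fcdf f) b) from ⟨h, le_of_lt hb⟩)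
      have hs0' : k (Fcdf f s) = 0 := hs0
      refine ⟨s, hs.1, lt_of_le_of_ne (hF1 s) fun h1 => ?_, fun x _ hx => ?_, fun x hx => ?_⟩
      · rw [h1] at hs0'
        exact hk1.ne' hs0'
      · exact hs0' ▸ hmono _ _ hx
      · exact hs0' ▸ hmono _ _ hx
  set c := f s / (1 - Fcdf f s)
  have hpt : ∀ x ∈ Ioi t, c * ((1 - Fcdf f x) * ((derivative W).eval (Fcdf f x) * f x)) ≤
      f x * ((derivative W).eval (Fcdf f x) * f x) := by
    intro x hx
    have hfx := hf.2.1 x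
    rw [hW]
    have hpe : 0 ≤ Fcdf f x ^ e := pow_nonneg (hF0 x) e
    suffices 0 ≤ (f x - c * (1 - Fcdf f x)) * k (Fcdf f x) by
      nlinarith [mul_nonneg this (mul_nonneg hpe hfx)]
    rcases (hF1 x).eq_or_lt with hx1 | hx1
    · rw [hx1]
      have : 0 ≤ f x * k 1 := by positivity
      simpa using this
    have hq : 0 < 1 - Fcdf f x := by linarith
    rcases le_total x s with hxs | hxs
    · have := (div_le_iff₀ hq).1 (hifr x s (le_of_lt hx) hxs hs1)
      exact mul_nonneg_of_nonpos_of_nonpos (by linarith) (hneg x hx hxs)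
    · have := (le_div_iff₀ hq).1 (hifr s x hts hxs hx1)
      exact mul_nonneg (by linarith) (hpos x hxs)
  set V : ℝ[X] := C (r / ((m : ℝ) + 1)) * (binomialTail (m + 1) m - binomialTail (m + 1) j)
  have hm1 : (0 : ℝ) < (m : ℝ) + 1 := by positivity
  have hV : ∀ u, (1 - u) * (derivative W).eval u = (derivative V).eval u := by
    intro u
    have h1 := congrArg (eval u) (one_sub_X_mul_derivative_binomialTail (le_refl m))
    have h2 := congrArg (eval u) (one_sub_X_mul_derivative_binomialTail hj.le)
    rw [show m + 1 - j = r by omega] at h2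
    rw [show m + 1 - m = 1 by omega] at h1
    simp only [eval_mul, eval_add, eval_sub, eval_natCast, eval_one, eval_X] at h1 h2
    simp [W, V]
    field_simp
    push_cast at h1
    linear_combination r * h1 - h2
  have hlow : c * (V.eval 1 - V.eval (Fcdf f t)) ≤
      ∫ x in Ioi t, f x * ((derivative W).eval (Fcdf f x) * f x) := by
    rw [← integral_Ioi_derivative_eval_Fcdf hf V t, ← integral_const_mul]
    refine setIntegral_mono_on
      ((integrable_eval_Fcdf_mul hf _ hf.integrable).const_mul _).integrableOn
      (integrable_mul_eval_Fcdf_mul hf _).integrableOn measurableSet_Ioi fun x hx => ?_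
    rw [← hV, mul_assoc]
    exact hpt x hx
  have hV1 : V.eval 1 = 0 := by
    simp [V, binomialTail_eval_one (show m ≤ m + 1 by omega),
      binomialTail_eval_one (show j ≤ m + 1 by omega)]
  have hVt : V.eval (Fcdf f t) ≤ 0 := by
    have := binomialTail_eval_anti hj.le (hF0 t) (hF1 t) (m + 1)
    simp only [V, eval_mul, eval_C, eval_sub]
    exact mul_nonpos_of_nonneg_of_nonpos (by positivity) (by linarith)
  have hq : 0 < 1 - Fcdf f t := by linarith
  have hmass : V.eval (Fcdf f t) ≤ (1 - Fcdf f t) * W.eval (Fcdf f t) := by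
    have := binomialTail_mass_le hj.le (hF0 t) (hF1 t)
    rw [← hrj] at this
    simp only [V, W, eval_mul, eval_C, eval_sub]
    rw [div_mul_eq_mul_div, div_le_iff₀ hm1]
    linear_combination this
  have hct := hifr t s le_rfl hts hs1
  have hft : f t = f t / (1 - Fcdf f t) * (1 - Fcdf f t) := by field_simp
  have hh : 0 ≤ f t / (1 - Fcdf f t) := div_nonneg (hf.2.1 t) hq.le
  rw [hV1] at hlow
  have h1 := mul_le_mul_of_nonneg_left hmass hh
  have h2 := mul_le_mul_of_nonpos_right hct hVt
  have h3 : f t * W.eval (Fcdf f t) =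
    f t / (1 - Fcdf f t) * ((1 - Fcdf f t) * W.eval (Fcdf f t)) := by field_simp
  rw [h3]
  linarith

lemma IsNoiseDensity.coe_lt_upper (hf : IsNoiseDensity f xl xu) {x : ℝ} (hx : Fcdf f x < 1) :
    (x : EReal) < xu := by
  by_contra! h
  have h0 : ∫ u in Ioi x, f u = 0 := by
    rw [setIntegral_congr_fun (g := fun _ => (0 : ℝ)) measurableSet_Ioi fun y hy =>
      hf.2.2.2.2.1 y (Or.inr (h.trans_lt (EReal.coe_lt_coe_iff.2 hy)))]
    simp
  have := intervalIntegral.integral_Iic_add_Ioi hf.integrable.integrableOn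
    (hf.integrable.integrableOn (s := Ioi x))
  rw [hf.2.2.2.1, h0, add_zero] at this
  exact hx.ne this

lemma continuousWithinAt_Ioi (hf : IsNoiseDensity f xl xu) {x : ℝ} (hx : Fcdf f x < 1)
    (hpos : 0 < f x) : ContinuousWithinAt f (Ioi x) x := by
  have hu := hf.coe_lt_upper hx
  have hl : xl ≤ x := by
    by_contra! h
    exact hpos.ne' (hf.2.2.2.2.1 x (Or.inl h))
  refine (hf.2.2.2.2.2 x ⟨hl, hu.le⟩).mono_of_mem_nhdsWithin ?_
  filter_upwards [self_mem_nhdsWithin, nhdsWithin_le_nhds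
    ((isOpen_Iio.preimage continuous_coe_real_ereal).mem_nhds hu)] with y hy hyu
  exact ⟨hl.trans (EReal.coe_le_coe_iff.2 (le_of_lt hy)), le_of_lt hyu⟩

/-- The hazard rate monotonicity extends to the closed half-line by right continuity. -/
lemma hazard_le_of_le (hf : IsNoiseDensity f xl xu) {xm : ℝ} (hpos : 0 < f xm)
    (hifr : ∀ x y : ℝ, xm < x → x ≤ y → Fcdf f x < 1 → Fcdf f y < 1 →
      f x / (1 - Fcdf f x) ≤ f y / (1 - Fcdf f y))
    {x y : ℝ} (hx : xm ≤ x) (hxy : x ≤ y) (hy : Fcdf f y < 1) :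
    f x / (1 - Fcdf f x) ≤ f y / (1 - Fcdf f y) := by
  rcases hxy.eq_or_lt with rfl | hxy'
  · rfl
  have hx1 : Fcdf f x < 1 := (monotone_Fcdf hf hxy).trans_lt hy
  rcases hx.eq_or_lt with rfl | hx'
  · have hlim : Tendsto (fun z => f z / (1 - Fcdf f z)) (𝓝[>] xm)
        (𝓝 (f xm / (1 - Fcdf f xm))) :=
      (continuousWithinAt_Ioi hf hx1 hpos).tendsto.div
        ((continuous_const.sub (continuous_Fcdf hf.integrable)).continuousWithinAt.tendsto)
        (by linarith)
    refine le_of_tendsto hlim ?_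
    filter_upwards [Ioo_mem_nhdsGT hxy'] with z hz
    exact hifr z y hz.1 hz.2.le ((monotone_Fcdf hf hz.2.le).trans_lt hy) hy
  · exact hifr x y hx' hxy hx1 hy

lemma sum_mul_sub_succ (n : ℕ) (v : ℕ → ℝ) :
    ∑ r ∈ Finset.Icc 1 n, (r : ℝ) * (v r - v (r + 1)) =
      (∑ r ∈ Finset.Icc 1 n, v r) - n * v (n + 1) := by
  induction n with
  | zero => simp
  | succ n ih =>
    rw [Finset.sum_Icc_succ_top (by omega), Finset.sum_Icc_succ_top (by omega), ih]
    push_cast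
    ring

/-- A marginal-benefit bound by per-rank bounds on the coefficients. -/
lemma gmb_le {n : ℕ} {v : ℕ → ℝ} (hv : IsPrizeSchedule n v) {t K : ℝ}
    (h : ∀ r, 1 ≤ r → r ≤ n → Bcoef f n r t ≤ r * K) : gmb f n v t ≤ K := by
  obtain ⟨hnonneg, hanti, hsum, hlast⟩ := hv
  calc gmb f n v t ≤ ∑ r ∈ Finset.Icc 1 n, K * ((r : ℝ) * (v r - v (r + 1))) := by
        refine Finset.sum_le_sum fun r hr => ?_
        have hr' := Finset.mem_Icc.1 hr
        have hd : 0 ≤ v r - v (r + 1) := by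
          rcases hr'.2.eq_or_lt with rfl | hlt
          · rw [hlast, sub_zero]
            exact hnonneg r hr
          · linarith [hanti r hr'.1 hlt]
        linarith [mul_le_mul_of_nonneg_right (h r hr'.1 hr'.2) hd]
    _ = K := by rw [← Finset.mul_sum, sum_mul_sub_succ, hsum, hlast]; ring

lemma gmb_winnerTakeAll {n : ℕ} (hn : 1 ≤ n) (t : ℝ) :
    gmb f n (fun r => if r = 1 then (1 : ℝ) else 0) t = Bcoef f n 1 t := by
  rw [gmb, Finset.sum_eq_single 1]
  · simp
  · intro r hr hr1
    have := (Finset.mem_Icc.1 hr).1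
    simp [hr1, show r ≠ 0 by omega]
  · simp [show n ≠ 0 by omega]

end Density

end

/-- If the largest global maximizer `xm` of the noise density is a mode,
`B_1` is maximized at `xm`, and the hazard rate is nondecreasing on `{x > xm : F x < 1}`,
then the winner-take-all schedule with the threshold at the global mode maximizes the
marginal benefit of effort over all thresholds and all prize schedules:
`g(t; v) ≤ g(xm; v^WTA) = B_1(xm)`. -/
theorem stmt7 (n : ℕ) (hn : 2 ≤ n) (f : ℝ → ℝ) (xl xu : EReal)
    (hf : IsNoiseDensity f xl xu) (hpm : PiecewiseMonotone f)
    (xm : ℝ) (hmax : ∀ x, f x ≤ f xm) (hlargest : ∀ x, f x = f xm → x ≤ xm)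
    (hmode : IsMode f xm)
    (hB1 : ∀ t : ℝ, Bcoef f n 1 t ≤ Bcoef f n 1 xm)
    (hifr : ∀ x y : ℝ, xm < x → x ≤ y → Fcdf f x < 1 → Fcdf f y < 1 →
      f x / (1 - Fcdf f x) ≤ f y / (1 - Fcdf f y)) :
    gmb f n (fun r => if r = 1 then (1 : ℝ) else 0) xm = Bcoef f n 1 xm ∧
      ∀ t : ℝ, ∀ v : ℕ → ℝ, IsPrizeSchedule n v → gmb f n v t ≤ Bcoef f n 1 xm := by
  refine ⟨gmb_winnerTakeAll (by omega) xm, fun t v hv => gmb_le hv fun r hr hrn => ?_⟩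
  obtain ⟨m, rfl⟩ : ∃ m, n = m + 1 := ⟨n - 1, by omega⟩
  obtain ⟨a, -, -, -, -, -, ha, -⟩ := hmode
  have hpos : 0 < f xm := (hf.2.1 a).trans_lt ha
  have hmain : ∀ s, xm ≤ s → Bcoef f (m + 1) r s ≤ r * Bcoef f (m + 1) 1 s := fun s hs =>
    Bcoef_le_mul_Bcoef_one hf (by omega) hr hrn fun x y hx hxy hy =>
      hazard_le_of_le hf hpos hifr (hs.trans hx) hxy hy
  rcases le_total t xm with ht | ht
  · exact (Bcoef_le_of_le hf hmax hr ht).trans (hmain xm le_rfl)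
  · exact (hmain t ht).trans (mul_le_mul_of_nonneg_left (hB1 t) r.cast_nonneg)
end

section
/- Let λ > 0 and let f be the exponential density, f(x) = λ·e^{−λx} for x ≥ 0 and f(x) = 0 for x < 0, with CDF F(x) = 1 − e^{−λx} for x ≥ 0. Then g(0; v) = λ/n for every prize schedule v ∈ 𝒱, and g(t; v) ≤ λ/n for every t ∈ ℝ and every v ∈ 𝒱. (For exponential noise, every prize schedule combined with the threshold at 0 attains the same maximal marginal benefit λ/n.) -/
open MeasureTheory

/-- The exponential density with rate `lam`. -/
noncomputable def expDensity (lam : ℝ) : ℝ → ℝ :=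
  fun x => if 0 ≤ x then lam * Real.exp (-(lam * x)) else 0

/-- The derivative of a binomial upper tail in the success probability telescopes. -/
lemma hasDerivAt_binomial_tail {n j : ℕ} (hj : 1 ≤ j) (hjn : j ≤ n) (p : ℝ) :
    HasDerivAt (fun p : ℝ => ∑ k ∈ Finset.Icc j n, (n.choose k : ℝ) * p ^ k * (1 - p) ^ (n - k))
      ((j : ℝ) * (n.choose j : ℝ) * p ^ (j - 1) * (1 - p) ^ (n - j)) p := by
  have key : ∀ k : ℕ, HasDerivAt (fun p : ℝ => (n.choose k : ℝ) * p ^ k * (1 - p) ^ (n - k))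
      ((n.choose k : ℝ) * (k * p ^ (k - 1)) * (1 - p) ^ (n - k) +
        (n.choose k : ℝ) * p ^ k * (((n - k : ℕ) : ℝ) * (1 - p) ^ (n - k - 1) * (-1))) p :=
    fun k => ((hasDerivAt_pow k p).const_mul _).mul
      (((hasDerivAt_id p).const_sub 1).pow (n - k))
  induction hjn using Nat.decreasingInduction with
  | self =>
    convert key n using 1
    · simp
    · simp
  | of_succ j hlt ih =>
    have hsum := (key j).add (ih (by omega))
    refine (hsum.congr_deriv ?_).congr_of_eventuallyEq (Filter.Eventually.of_forall fun x => ?_)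
    rotate_left
    · beta_reduce
      rw [Pi.add_apply, ← Finset.insert_Icc_succ_left_eq_Icc hlt.le,
        Finset.sum_insert (by simp)]
      rfl
    · have hc : ((j + 1 : ℕ) : ℝ) * (n.choose (j + 1) : ℝ) =
          (n.choose j : ℝ) * ((n - j : ℕ) : ℝ) := by
        rw [mul_comm]
        exact_mod_cast Nat.choose_succ_right_eq n j
      rw [hc, Nat.add_sub_cancel, Nat.sub_sub]
      ring

lemma expDensity_of_nonneg (lam : ℝ) {x : ℝ} (hx : 0 ≤ x) :
    expDensity lam x = lam * Real.exp (-(lam * x)) := if_pos hx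

lemma expDensity_of_neg (lam : ℝ) {x : ℝ} (hx : x < 0) : expDensity lam x = 0 :=
  if_neg hx.not_ge

lemma hasDerivAt_one_sub_exp (lam x : ℝ) :
    HasDerivAt (fun x : ℝ => 1 - Real.exp (-(lam * x))) (lam * Real.exp (-(lam * x))) x := by
  have h := ((((hasDerivAt_id x).const_mul lam).neg).exp).const_sub 1
  refine h.congr_deriv ?_
  simp [mul_comm]

lemma Fcdf_expDensity (lam : ℝ) {x : ℝ} (hx : 0 ≤ x) :
    Fcdf (expDensity lam) x = 1 - Real.exp (-(lam * x)) := by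
  unfold Fcdf
  rw [setIntegral_eq_of_subset_of_forall_sdiff_eq_zero measurableSet_Iic
    (Set.Icc_subset_Iic_self : Set.Icc 0 x ⊆ Set.Iic x)
    (fun y hy => expDensity_of_neg lam (not_le.1 fun h => hy.2 ⟨h, hy.1⟩)),
    setIntegral_congr_fun measurableSet_Icc
      (fun y hy => expDensity_of_nonneg lam (Set.mem_Icc.1 hy).1),
    integral_Icc_eq_integral_Ioc, ← intervalIntegral.integral_of_le hx,
    intervalIntegral.integral_eq_sub_of_hasDerivAt (fun y _ => hasDerivAt_one_sub_exp lam y)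
      (Continuous.intervalIntegrable (by fun_prop) _ _)]
  simp

/-- The binomial coefficients `C(n-1, k)` and `C(n, k)` differ by the factor `(n-k)/n`. -/
lemma choose_pred_eq {n k : ℕ} (hn : 1 ≤ n) (hk : k ≤ n) :
    ((n - 1).choose k : ℝ) = (n.choose k : ℝ) * ((n : ℝ) - k) / n := by
  obtain ⟨m, rfl⟩ : ∃ m, n = m + 1 := ⟨n - 1, by omega⟩
  have h := Nat.choose_mul_succ_eq m k
  have hR : (m.choose k : ℝ) * ((m + 1 : ℕ) : ℝ) =
      ((m + 1).choose k : ℝ) * ((m + 1 - k : ℕ) : ℝ) := by exact_mod_cast h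
  rw [Nat.cast_sub hk] at hR
  rw [eq_div_iff (by positivity)]
  simpa using hR

/-- The tail integral of `f · f_{(n-r:n-1)}` for exponential noise is a multiple of the tail
of the `(n-r)`-th order statistic among `n` draws. -/
lemma integral_expDensity_mul_fos {n r : ℕ} (hr : 1 ≤ r) (hrn : r < n) {lam : ℝ}
    (hlam : 0 < lam) {t : ℝ} (ht : 0 ≤ t) :
    ∫ x in Set.Ioi t, expDensity lam x * fos (expDensity lam) (n - r) (n - 1) x =
      lam * (r / n) * (1 - Fos (expDensity lam) (n - r) n t) := by
  have hj : n - r ≠ 0 := by omega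
  set S : ℝ → ℝ := fun p => ∑ k ∈ Finset.Icc (n - r) n,
    (n.choose k : ℝ) * p ^ k * (1 - p) ^ (n - k) with hS
  have hderiv : ∀ p, HasDerivAt S _ p := fun p =>
    hasDerivAt_binomial_tail (show 1 ≤ n - r by omega) (Nat.sub_le n r) p
  have hS1 : S 1 = 1 := by
    rw [hS]
    simp only [one_pow, mul_one, sub_self]
    rw [Finset.sum_eq_single n]
    · simp
    · intro k hk hkn
      rw [Finset.mem_Icc] at hk
      rw [zero_pow (by omega), mul_zero]
    · simp
  have hφ : ∀ x : ℝ, HasDerivAt (fun x => lam * (r / n) * S (1 - Real.exp (-(lam * x)))) _ x :=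
    fun x => ((hderiv _).comp x (hasDerivAt_one_sub_exp lam x)).const_mul _
  have hlim : Filter.Tendsto (fun x => lam * (r / n) * S (1 - Real.exp (-(lam * x))))
      Filter.atTop (nhds (lam * (r / n) * S 1)) := by
    refine Filter.Tendsto.const_mul _ ((hderiv 1).continuousAt.tendsto.comp ?_)
    have h : Filter.Tendsto (fun x : ℝ => Real.exp (-(lam * x))) Filter.atTop (nhds 0) :=
      Real.tendsto_exp_neg_atTop_nhds_zero.comp (Filter.tendsto_id.const_mul_atTop hlam)
    simpa using h.const_sub 1
  have hint := integral_Ioi_of_hasDerivAt_of_nonneg' (a := t) (fun x _ => hφ x) (fun x hx => ?_) hlim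
  · rw [hS1] at hint
    have hFos : Fos (expDensity lam) (n - r) n t = S (1 - Real.exp (-(lam * t))) := by
      rw [Fos, if_neg hj, Fcdf_expDensity lam ht]
    rw [hFos, mul_sub, ← hint]
    refine setIntegral_congr_fun measurableSet_Ioi fun x hx => ?_
    have hx0 : 0 ≤ x := ht.trans (le_of_lt hx)
    have hpow : n - (n - r) = n - 1 - (n - r) + 1 := by omega
    simp only [fos, if_neg hj, Fcdf_expDensity lam hx0, expDensity_of_nonneg lam hx0]
    rw [choose_pred_eq (by omega) (Nat.sub_le n r), hpow, pow_succ, Nat.cast_sub hrn.le]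
    ring
  · have hx0 : 0 ≤ x := ht.trans (le_of_lt hx)
    have h1 : 0 ≤ 1 - Real.exp (-(lam * x)) := by
      rw [sub_nonneg, Real.exp_le_one_iff]
      nlinarith
    have h2 : 0 ≤ 1 - (1 - Real.exp (-(lam * x))) := by
      rw [sub_sub_cancel]
      positivity
    positivity

lemma Fos_expDensity_zero {j m : ℕ} (hj : j ≠ 0) (lam : ℝ) :
    Fos (expDensity lam) j m 0 = 0 := by
  rw [Fos, if_neg hj, Fcdf_expDensity lam le_rfl]
  refine Finset.sum_eq_zero fun k hk => ?_
  rw [Finset.mem_Icc] at hk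
  simp [show k ≠ 0 by omega]

lemma expDensity_mul_Fos_le {n r : ℕ} (hrn : r < n) {lam : ℝ}
    (hlam : 0 < lam) {t : ℝ} (ht : 0 ≤ t) :
    expDensity lam t * Fos (expDensity lam) (n - r) (n - 1) t ≤
      lam * (r / n) * Fos (expDensity lam) (n - r) n t := by
  have hj : n - r ≠ 0 := by omega
  have hn0 : (0 : ℝ) < n := by
    exact_mod_cast (show 0 < n by omega)
  rw [Fos, Fos, if_neg hj, if_neg hj, expDensity_of_nonneg lam ht, Fcdf_expDensity lam ht,
    mul_assoc, mul_assoc]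
  refine mul_le_mul_of_nonneg_left ?_ hlam.le
  have hp : 0 ≤ 1 - Real.exp (-(lam * t)) := by
    rw [sub_nonneg, Real.exp_le_one_iff]
    nlinarith
  have hq : 0 ≤ Real.exp (-(lam * t)) := (Real.exp_pos _).le
  rw [sub_sub_cancel]
  set q := Real.exp (-(lam * t))
  rw [Finset.mul_sum, Finset.mul_sum]
  refine (Finset.sum_le_sum (g := fun k => (r / n : ℝ) *
    ((n.choose k : ℝ) * (1 - q) ^ k * q ^ (n - k))) fun k hk => ?_).trans
    (Finset.sum_le_sum_of_subset_of_nonneg (Finset.Icc_subset_Icc_right (Nat.sub_le n 1))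
      fun k _ _ => by positivity)
  rw [Finset.mem_Icc] at hk
  have hkr : (n : ℝ) - k ≤ r := by
    have : n ≤ r + k := by omega
    have : (n : ℝ) ≤ r + k := by exact_mod_cast this
    linarith
  rw [choose_pred_eq (by omega) (by omega), show n - k = n - 1 - k + 1 by omega, pow_succ]
  calc q * ((n.choose k : ℝ) * (n - k) / n * (1 - q) ^ k * q ^ (n - 1 - k))
      = (n - k) * ((n.choose k : ℝ) / n * (1 - q) ^ k * q ^ (n - 1 - k) * q) := by ring
    _ ≤ r * ((n.choose k : ℝ) / n * (1 - q) ^ k * q ^ (n - 1 - k) * q) :=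
        mul_le_mul_of_nonneg_right hkr (by positivity)
    _ = _ := by ring

lemma Bcoef_self (f : ℝ → ℝ) (n : ℕ) (t : ℝ) : Bcoef f n n t = f t := by
  simp [Bcoef, Fos, fos]

lemma Bcoef_expDensity_zero {n r : ℕ} (hr : 1 ≤ r) (hrn : r ≤ n) {lam : ℝ} (hlam : 0 < lam) :
    Bcoef (expDensity lam) n r 0 = lam / n * r := by
  rcases hrn.eq_or_lt with rfl | hlt
  · have hr0 : (r : ℝ) ≠ 0 := by positivity
    rw [Bcoef_self, expDensity_of_nonneg lam le_rfl, div_mul_cancel₀ _ hr0]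
    simp
  · have hj : n - r ≠ 0 := by omega
    rw [Bcoef, integral_expDensity_mul_fos hr hlt hlam le_rfl, Fos_expDensity_zero hj,
      Fos_expDensity_zero hj]
    ring

/-- Below the support, the marginal-benefit coefficients lose only the term `f t`. -/
lemma Bcoef_expDensity_of_neg {n r : ℕ} (hrn : r < n) (lam : ℝ) {t : ℝ} (ht : t < 0) :
    Bcoef (expDensity lam) n r t = Bcoef (expDensity lam) n r 0 := by
  have hj : n - r ≠ 0 := by omega
  rw [Bcoef, Bcoef, Fos_expDensity_zero hj, expDensity_of_neg lam ht, zero_mul, mul_zero,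
    ← integral_Ici_eq_integral_Ioi (x := (0 : ℝ)),
    setIntegral_eq_of_subset_of_forall_sdiff_eq_zero measurableSet_Ioi
      (Set.Ici_subset_Ioi.2 ht : Set.Ici (0 : ℝ) ⊆ Set.Ioi t)]
  intro x hx
  rw [expDensity_of_neg lam (not_le.1 hx.2), zero_mul]

lemma Bcoef_expDensity_le {n r : ℕ} (hr : 1 ≤ r) (hrn : r ≤ n) {lam : ℝ} (hlam : 0 < lam)
    (t : ℝ) : Bcoef (expDensity lam) n r t ≤ lam / n * r := by
  rcases hrn.eq_or_lt with rfl | hlt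
  · have hr0 : (r : ℝ) ≠ 0 := by positivity
    rw [Bcoef_self, div_mul_cancel₀ _ hr0]
    rcases lt_or_ge t 0 with ht | ht
    · rw [expDensity_of_neg lam ht]
      exact hlam.le
    · rw [expDensity_of_nonneg lam ht]
      refine mul_le_of_le_one_right hlam.le (Real.exp_le_one_iff.2 ?_)
      nlinarith
  · rcases lt_or_ge t 0 with ht | ht
    · rw [Bcoef_expDensity_of_neg hlt lam ht, Bcoef_expDensity_zero hr hrn hlam]
    · have h := expDensity_mul_Fos_le hlt hlam ht
      rw [Bcoef, integral_expDensity_mul_fos hr hlt hlam ht]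
      calc _ ≤ _ := add_le_add_left h _
        _ = _ := by ring

/-- Summation by parts. -/
lemma sum_nat_mul_sub_succ (v : ℕ → ℝ) (n : ℕ) :
    ∑ r ∈ Finset.Icc 1 n, (r : ℝ) * (v r - v (r + 1)) =
      ∑ r ∈ Finset.Icc 1 n, v r - n * v (n + 1) := by
  induction n with
  | zero => simp
  | succ n ih =>
    rw [Finset.sum_Icc_succ_top (by omega), Finset.sum_Icc_succ_top (by omega), ih]
    push_cast
    ring

lemma IsPrizeSchedule.sum_mul_sub {n : ℕ} {v : ℕ → ℝ} (hv : IsPrizeSchedule n v) (c : ℝ) :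
    ∑ r ∈ Finset.Icc 1 n, c * r * (v r - v (r + 1)) = c := by
  obtain ⟨-, -, hsum, hlast⟩ := hv
  simp_rw [mul_assoc]
  rw [← Finset.mul_sum, sum_nat_mul_sub_succ, hsum, hlast]
  ring

lemma IsPrizeSchedule.succ_le {n : ℕ} {v : ℕ → ℝ} (hv : IsPrizeSchedule n v) {r : ℕ}
    (hr : r ∈ Finset.Icc 1 n) : v (r + 1) ≤ v r := by
  obtain ⟨h1, h2⟩ := Finset.mem_Icc.1 hr
  rcases h2.eq_or_lt with rfl | hlt
  · rw [hv.2.2.2]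
    exact hv.1 _ hr
  · exact hv.2.1 r h1 hlt

/-- For exponential noise with rate `λ`, every prize schedule combined with
the threshold at `0` attains the marginal benefit `λ/n`, and this is maximal over all
thresholds and prize schedules. -/
theorem stmt9 (n : ℕ) (hn : 2 ≤ n) (lam : ℝ) (hlam : 0 < lam) :
    (∀ v : ℕ → ℝ, IsPrizeSchedule n v → gmb (expDensity lam) n v 0 = lam / (n : ℝ)) ∧
      ∀ t : ℝ, ∀ v : ℕ → ℝ, IsPrizeSchedule n v →
        gmb (expDensity lam) n v t ≤ lam / (n : ℝ) := by
  refine ⟨fun v hv => ?_, fun t v hv => ?_⟩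
  · rw [gmb, ← hv.sum_mul_sub (lam / n)]
    refine Finset.sum_congr rfl fun r hr => ?_
    obtain ⟨h1, h2⟩ := Finset.mem_Icc.1 hr
    rw [Bcoef_expDensity_zero h1 h2 hlam]
  · rw [gmb, ← hv.sum_mul_sub (lam / n)]
    refine Finset.sum_le_sum fun r hr => ?_
    obtain ⟨h1, h2⟩ := Finset.mem_Icc.1 hr
    exact mul_le_mul_of_nonneg_right (Bcoef_expDensity_le h1 h2 hlam t)
      (sub_nonneg.2 (hv.succ_le hr))
end
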